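/- There is an absolute constant c > 0 such that the following holds. Let X be any Banach space, let w* ⊂ ℝ be a finite interval and let w'_1, w'_2, w'_3, w'_4 be its four consecutive closed quarters (each of length |w*|/4). Then for every f ∈ L_1(w*; X), every x ∈ ℝ, and all real numbers k, k'' ≥ 0 with |k − k''| · |w*| ≤ 4, one has ‖ ∫_{w*} f(t) ( e^{2πik(x−t)} − e^{2πik''(x−t)} ) / (x−t) dt ‖_X ≤ c · Σ_{i=1}^{4} C_{[k''|w*|/4]}(f, w'_i), where [·] denotes the integer part and the integrand is extended by its limit 2πi(k−k'') e^{2πik''(x−t)}·(corrected value) at t = x (the kernel (e^{2πik(x−t)} − e^{2πik''(x−t)})/(x−t) has a removable singularity at t = x). -/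

import Mathlib

open MeasureTheory Filter Set Topology Real
open scoped ENNReal NNReal

noncomputable section

universe u
section
variable {X : Type*} [NormedAddCommGroup X] [NormedSpace ℂ X]

/-- Generalized Fourier coefficient on the interval `w = (a,b)`:
`f̂_w(α) = (1/|w|) ∫_w f(t) e^{-2πiαt/|w|} dt`. -/
def intervalFourierCoeff (f : ℝ → X) (a b : ℝ) (α : ℝ) : X :=
  (b - a)⁻¹ • ∫ t in Ioo a b,
    Complex.exp (-(2 * (π : ℂ) * Complex.I * (α : ℂ) * (t : ℂ)) / ((b : ℂ) - (a : ℂ))) • f t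

/-- `X` has Fourier type `p` with constant `c`. -/
def HasFourierTypeWith (X : Type*) [NormedAddCommGroup X] [NormedSpace ℂ X]
    (p c : ℝ) : Prop :=
  ∀ a b : ℝ, a < b → ∀ f : ℝ → X, AEStronglyMeasurable f (volume.restrict (Ioo a b)) →
    (∑' k : ℤ, (‖intervalFourierCoeff f a b k‖₊ : ℝ≥0∞) ^ (p / (p - 1))) ^ ((p - 1) / p)
      ≤ ENNReal.ofReal c *
        ((ENNReal.ofReal (b - a))⁻¹ * ∫⁻ t in Ioo a b, (‖f t‖₊ : ℝ≥0∞) ^ p) ^ (1 / p)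

/-- `log⁺ u = max (log u) 0`. -/
def logPlus (u : ℝ) : ℝ := max (Real.log u) 0

/-- The normalized `L (log L)^β` "norm" `(1/|w|) ∫_w ‖f‖ (log⁺‖f‖)^β` on `w = (a,b)`. -/
def avgLlogL (f : ℝ → X) (β a b : ℝ) : ℝ≥0∞ :=
  (ENNReal.ofReal (b - a))⁻¹ *
    ∫⁻ x in Ioo a b, ENNReal.ofReal (‖f x‖ * logPlus ‖f x‖ ^ β)

/-- Carleson average `C_k(f,w) = γ⁻¹ Σ_μ ‖f̂_w(k+μ/3)‖/(1+μ²)`. -/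
def carlesonAvg (f : ℝ → X) (a b : ℝ) (k : ℤ) : ℝ :=
  (∑' μ : ℤ, (1 + (μ : ℝ) ^ 2)⁻¹)⁻¹ *
    ∑' μ : ℤ, ‖intervalFourierCoeff f a b ((k : ℝ) + (μ : ℝ) / 3)‖ / (1 + (μ : ℝ) ^ 2)
end

theorem norm_fourierCoeffOn_le {a b : ℝ} (hab : a < b) {h : ℝ → ℂ} {M : ℝ}
    (hM : ∀ u ∈ Icc a b, ‖h u‖ ≤ M) (n : ℤ) : ‖fourierCoeffOn hab h n‖ ≤ M := by
  have hpos : 0 < b - a := sub_pos.2 hab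
  have hint : ‖∫ u in a..b, fourier (-n) (u : AddCircle (b - a)) • h u‖ ≤ M * |b - a| := by
    refine intervalIntegral.norm_integral_le_of_norm_le_const fun u hu => ?_
    rw [uIoc_of_le hab.le] at hu
    rw [norm_smul, fourier_apply, Circle.norm_coe, one_mul]
    exact hM u (Ioc_subset_Icc_self hu)
  rw [fourierCoeffOn_eq_integral, norm_smul, Real.norm_of_nonneg (by positivity)]
  rw [abs_of_pos hpos] at hint
  calc 1 / (b - a) * _ ≤ 1 / (b - a) * (M * (b - a)) := by gcongr
    _ = M := by field_simp

theorem norm_fourierCoeffOn_eq_of_hasDerivAt {a b : ℝ} (hab : a < b) {h h' : ℝ → ℂ}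
    (hd : ∀ u, HasDerivAt h (h' u) u) (hc : Continuous h') (hper : h a = h b)
    {n : ℤ} (hn : n ≠ 0) :
    ‖fourierCoeffOn hab h n‖ = (b - a) / (2 * π * |(n : ℝ)|) * ‖fourierCoeffOn hab h' n‖ := by
  have hpos : 0 < b - a := sub_pos.2 hab
  have hba : ‖(b : ℂ) - (a : ℂ)‖ = b - a := by
    rw [← Complex.ofReal_sub, Complex.norm_real, Real.norm_of_nonneg hpos.le]
  rw [fourierCoeffOn_of_hasDerivAt hab hn (fun u _ => hd u) (hc.intervalIntegrable _ _), hper]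
  simp only [sub_self, mul_zero, zero_sub, norm_mul, norm_neg, norm_div, hba, norm_one,
    Complex.norm_I, Complex.norm_intCast, Complex.norm_real, Real.norm_of_nonneg pi_pos.le,
    Complex.norm_ofNat]
  ring

theorem norm_fourierCoeffOn_le_div {a b : ℝ} (hab : a < b) (hlen : b - a ≤ 3)
    {h h' h'' : ℝ → ℂ} (hd : ∀ u, HasDerivAt h (h' u) u) (hd' : ∀ u, HasDerivAt h' (h'' u) u)
    (hc : Continuous h'') (hper : h a = h b) (hper' : h' a = h' b) {M : ℝ}
    (hM : ∀ u ∈ Icc a b, ‖h u‖ ≤ M) (hM'' : ∀ u ∈ Icc a b, ‖h'' u‖ ≤ M) (n : ℤ) :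
    ‖fourierCoeffOn hab h n‖ ≤ M / (1 + (n : ℝ) ^ 2) := by
  rcases eq_or_ne n 0 with rfl | hn
  · simpa using norm_fourierCoeffOn_le hab hM 0
  have hM0 : 0 ≤ M := (norm_nonneg _).trans (hM a (left_mem_Icc.2 hab.le))
  have hc' : Continuous h' := continuous_iff_continuousAt.2 fun u => (hd' u).continuousAt
  have h1 : 1 ≤ |(n : ℝ)| := by exact_mod_cast Int.one_le_abs hn
  have hr : (b - a) / (2 * π * |(n : ℝ)|) ≤ 1 / (2 * |(n : ℝ)|) := by
    rw [div_le_div_iff₀ (by positivity) (by positivity)]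
    nlinarith [pi_gt_three]
  have hr0 : 0 ≤ (b - a) / (2 * π * |(n : ℝ)|) := by
    have : 0 < b - a := sub_pos.2 hab
    positivity
  rw [norm_fourierCoeffOn_eq_of_hasDerivAt hab hd hc' hper hn,
    norm_fourierCoeffOn_eq_of_hasDerivAt hab hd' hc hper' hn]
  calc _ ≤ 1 / (2 * |(n : ℝ)|) * (1 / (2 * |(n : ℝ)|) * M) := by
        gcongr
        exact norm_fourierCoeffOn_le hab hM'' n
    _ = M / (4 * |(n : ℝ)| ^ 2) := by ring
    _ ≤ M / (1 + (n : ℝ) ^ 2) := by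
        rw [← sq_abs (n : ℝ)]
        gcongr
        nlinarith

theorem exists_cutoff : ∃ (χ χ' χ'' : ℝ → ℝ) (M : ℝ),
    (∀ u, HasDerivAt χ (χ' u) u) ∧ (∀ u, HasDerivAt χ' (χ'' u) u) ∧ Continuous χ'' ∧
    (∀ u, |u| ≤ 1 / 2 → χ u = 1) ∧ (∀ u, 1 < |u| → χ u = 0 ∧ χ' u = 0) ∧
    ∀ u ∈ Icc (-3 / 2 : ℝ) (-3 / 2 + 3), |χ u| ≤ M ∧ |χ' u| ≤ M ∧ |χ'' u| ≤ M := by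
  let χ : ContDiffBump (0 : ℝ) := ⟨1 / 2, 1, by norm_num, by norm_num⟩
  have hχ : ContDiff ℝ 2 χ := χ.contDiff
  have hχ' : ContDiff ℝ 1 (deriv χ) := hχ.deriv'
  have hχ'' : Continuous (deriv (deriv χ)) := hχ'.continuous_deriv le_rfl
  have hzero : ∀ u : ℝ, 1 < |u| → χ u = 0 := fun u hu =>
    χ.zero_of_le_dist (by simpa [χ, Real.dist_eq] using hu.le)
  obtain ⟨M₀, h₀⟩ := isCompact_Icc.exists_bound_of_continuousOn
    (s := Icc (-3 / 2 : ℝ) (-3 / 2 + 3)) hχ.continuous.continuousOn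
  obtain ⟨M₁, h₁⟩ := isCompact_Icc.exists_bound_of_continuousOn
    (s := Icc (-3 / 2 : ℝ) (-3 / 2 + 3)) hχ'.continuous.continuousOn
  obtain ⟨M₂, h₂⟩ := isCompact_Icc.exists_bound_of_continuousOn
    (s := Icc (-3 / 2 : ℝ) (-3 / 2 + 3)) hχ''.continuousOn
  refine ⟨χ, deriv χ, deriv (deriv χ), max M₀ (max M₁ M₂),
    fun u => (hχ.differentiable (by norm_num) u).hasDerivAt,
    fun u => (hχ'.differentiable (by norm_num) u).hasDerivAt, hχ'',
    fun u hu => χ.one_of_mem_closedBall (by simpa [χ] using hu),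
    fun u hu => ⟨hzero u hu, ?_⟩, fun u hu => ⟨?_, ?_, ?_⟩⟩
  · have : (χ : ℝ → ℝ) =ᶠ[𝓝 u] fun _ => 0 := by
      filter_upwards [(isOpen_lt continuous_const continuous_abs).mem_nhds hu] with v hv
      exact hzero v hv
    rw [this.deriv_eq, deriv_const]
  · exact (h₀ u hu).trans (le_max_left _ _)
  · exact (h₁ u hu).trans ((le_max_left _ _).trans (le_max_right _ _))
  · exact (h₂ u hu).trans ((le_max_right _ _).trans (le_max_right _ _))

theorem summable_one_add_sq_inv : Summable fun n : ℤ => (1 + (n : ℝ) ^ 2)⁻¹ := by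
  refine Summable.of_norm_bounded_eventually
    (g := fun n : ℤ => 1 / (n : ℝ) ^ 2) (Real.summable_one_div_int_pow.2 (by norm_num)) ?_
  filter_upwards [(Set.finite_singleton (0 : ℤ)).compl_mem_cofinite] with n hn
  have : (0 : ℝ) < (n : ℝ) ^ 2 := by
    have : (n : ℝ) ≠ 0 := by exact_mod_cast hn
    positivity
  rw [Real.norm_of_nonneg (by positivity), one_div]
  gcongr
  linarith

/-- A character of frequency at most `2` agrees on `[-1/2, 1/2]` with a Fourier series of
period `3` whose coefficients decay quadratically, uniformly in the frequency. -/
theorem exists_hasSum_exp : ∃ D : ℝ, 0 < D ∧ ∀ lam : ℝ, |lam| ≤ 2 → ∃ c : ℤ → ℂ,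
    (∀ μ : ℤ, ‖c μ‖ ≤ D / (1 + (μ : ℝ) ^ 2)) ∧
    ∀ u : ℝ, |u| ≤ 1 / 2 → HasSum (fun μ : ℤ => c μ * Complex.exp (2 * π * Complex.I * μ * u / 3))
      (Complex.exp (2 * π * Complex.I * lam * u)) := by
  obtain ⟨χ, χ', χ'', M, hd, hd', hcont, hone, hzero, hM⟩ := exists_cutoff
  have hM1 : 1 ≤ M := by
    have := (hM 0 (by norm_num)).1
    rwa [hone 0 (by norm_num), abs_one] at this
  refine ⟨M * (1 + 4 * π) ^ 2, by positivity, fun lam hlam => ?_⟩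
  set w : ℂ := 2 * π * Complex.I * lam with hw
  have hwn : ‖w‖ ≤ 4 * π := by
    simp only [hw, norm_mul, Complex.norm_I, Complex.norm_real, Complex.norm_ofNat,
      Real.norm_of_nonneg pi_pos.le, Real.norm_eq_abs]
    nlinarith [pi_pos]
  have hexpn : ∀ u : ℝ, ‖Complex.exp (w * u)‖ = 1 := fun u => by
    rw [show w * u = ((2 * π * lam * u : ℝ) : ℂ) * Complex.I by rw [hw]; push_cast; ring,
      Complex.norm_exp_ofReal_mul_I]
  have he : ∀ u : ℝ, HasDerivAt (fun u : ℝ => Complex.exp (w * u)) (w * Complex.exp (w * u)) u :=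
    fun u => by
      have := ((Complex.ofRealCLM.hasDerivAt (x := u)).const_mul w).cexp
      simpa [mul_comm] using this
  let h : ℝ → ℂ := fun u => χ u * Complex.exp (w * u)
  let h' : ℝ → ℂ := fun u => (χ' u + w * χ u) * Complex.exp (w * u)
  let h'' : ℝ → ℂ := fun u => (χ'' u + 2 * w * χ' u + w ^ 2 * χ u) * Complex.exp (w * u)
  have hh : ∀ u, HasDerivAt h (h' u) u := fun u => by
    refine ((hd u).ofReal_comp.mul (he u)).congr_deriv ?_
    simp only [h']; ring
  have hh' : ∀ u, HasDerivAt h' (h'' u) u := fun u => by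
    refine (((hd' u).ofReal_comp.add ((hd u).ofReal_comp.const_mul w)).mul (he u)).congr_deriv ?_
    simp only [h'']
    simp only [Pi.add_apply]
    ring
  have hχc : Continuous χ := continuous_iff_continuousAt.2 fun u => (hd u).continuousAt
  have hχc' : Continuous χ' := continuous_iff_continuousAt.2 fun u => (hd' u).continuousAt
  have hcc : Continuous h'' := by fun_prop
  have hch : Continuous h := by fun_prop
  have hl := hzero (-3 / 2) (by rw [abs_of_neg] <;> norm_num)
  have hr := hzero (-3 / 2 + 3) (by rw [abs_of_pos] <;> norm_num)
  have hper : h (-3 / 2) = h (-3 / 2 + 3) := by simp only [h, hl.1, hr.1]; simp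
  have hper' : h' (-3 / 2) = h' (-3 / 2 + 3) := by simp only [h', hl.1, hr.1, hl.2, hr.2]; simp
  have : Fact ((0 : ℝ) < 3) := ⟨by norm_num⟩
  let F : C(AddCircle (3 : ℝ), ℂ) :=
    ⟨AddCircle.liftIco 3 (-3 / 2) h, AddCircle.liftIco_continuous hper hch.continuousOn⟩
  have hF : ∀ μ : ℤ, ‖fourierCoeff F μ‖ ≤ M * (1 + 4 * π) ^ 2 / (1 + (μ : ℝ) ^ 2) := fun μ => by
    change ‖fourierCoeff (AddCircle.liftIco 3 (-3 / 2) h) μ‖ ≤ _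
    rw [fourierCoeff_liftIco_eq]
    refine norm_fourierCoeffOn_le_div _ (by norm_num) hh hh' hcc hper hper' (fun u hu => ?_)
      (fun u hu => ?_) μ
    · obtain ⟨h0, -, -⟩ := hM u hu
      simp only [h, norm_mul, hexpn, mul_one, Complex.norm_real, Real.norm_eq_abs]
      have : 1 ≤ (1 + 4 * π) ^ 2 := by nlinarith [pi_pos]
      nlinarith
    · obtain ⟨h0, h1, h2⟩ := hM u hu
      simp only [h'', norm_mul, hexpn, mul_one]
      refine (norm_add₃_le).trans ?_
      simp only [norm_mul, norm_pow, Complex.norm_real, Real.norm_eq_abs, Complex.norm_ofNat]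
      calc _ ≤ M + 2 * (4 * π) * M + (4 * π) ^ 2 * M := by gcongr
        _ = _ := by ring
  have hsum : Summable (fourierCoeff F) :=
    Summable.of_norm_bounded (summable_one_add_sq_inv.mul_left (M * (1 + 4 * π) ^ 2)) fun μ => by
      simpa [div_eq_mul_inv] using hF μ
  refine ⟨fourierCoeff F, hF, fun u hu => ?_⟩
  have hu' := abs_le.1 hu
  have key := has_pointwise_sum_fourier_series_of_summable hsum (u : AddCircle (3 : ℝ))
  have hFu : F (u : AddCircle (3 : ℝ)) = Complex.exp (w * u) := by
    change AddCircle.liftIco 3 (-3 / 2) h (u : AddCircle (3 : ℝ)) = _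
    rw [AddCircle.liftIco_coe_apply ⟨by linarith, by linarith⟩]
    simp [h, hone u hu]
  rw [hFu] at key
  simpa only [fourier_coe_apply, smul_eq_mul, Complex.ofReal_ofNat] using key

theorem norm_exp_fourier_kernel (a b α t : ℝ) :
    ‖Complex.exp (-(2 * (π : ℂ) * Complex.I * (α : ℂ) * (t : ℂ)) / ((b : ℂ) - (a : ℂ)))‖ = 1 := by
  rw [show -(2 * (π : ℂ) * Complex.I * (α : ℂ) * (t : ℂ)) / ((b : ℂ) - (a : ℂ))
      = ((-(2 * π * α * t) / (b - a) : ℝ) : ℂ) * Complex.I by push_cast; ring,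
    Complex.norm_exp_ofReal_mul_I]

theorem MeasureTheory.Integrable.exp_fourier_kernel_smul {X : Type*} [NormedAddCommGroup X]
    [NormedSpace ℂ X] {f : ℝ → X} {ν : Measure ℝ} (hf : Integrable f ν) (a b α : ℝ) :
    Integrable (fun t : ℝ => Complex.exp (-(2 * (π : ℂ) * Complex.I * (α : ℂ) * (t : ℂ)) /
      ((b : ℂ) - (a : ℂ))) • f t) ν := by
  refine hf.mono (Continuous.aestronglyMeasurable (by fun_prop) |>.smul hf.1) (.of_forall fun t => ?_)
  rw [norm_smul, norm_exp_fourier_kernel, one_mul]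

theorem norm_integral_exp_fourier_kernel_smul {X : Type*} [NormedAddCommGroup X]
    [NormedSpace ℂ X] (f : ℝ → X) {a b : ℝ} (hab : a < b) (α : ℝ) :
    ‖∫ t in Ioo a b, Complex.exp (-(2 * (π : ℂ) * Complex.I * (α : ℂ) * (t : ℂ)) /
      ((b : ℂ) - (a : ℂ))) • f t‖ = (b - a) * ‖intervalFourierCoeff f a b α‖ := by
  have hpos : 0 < b - a := sub_pos.2 hab
  rw [intervalFourierCoeff, norm_smul, norm_inv, Real.norm_of_nonneg hpos.le,
    mul_inv_cancel_left₀ hpos.ne']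

theorem summable_carlesonAvg {X : Type*} [NormedAddCommGroup X] [NormedSpace ℂ X]
    (f : ℝ → X) {a b : ℝ} (hab : a < b) (k : ℤ) :
    Summable fun μ : ℤ =>
      ‖intervalFourierCoeff f a b ((k : ℝ) + (μ : ℝ) / 3)‖ / (1 + (μ : ℝ) ^ 2) := by
  have hpos : 0 < b - a := sub_pos.2 hab
  refine Summable.of_nonneg_of_le (fun μ => by positivity) (fun μ => ?_)
    (summable_one_add_sq_inv.mul_left ((b - a)⁻¹ * ∫ t in Ioo a b, ‖f t‖))
  rw [div_eq_mul_inv]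
  gcongr
  rw [intervalFourierCoeff, norm_smul, norm_inv, Real.norm_of_nonneg hpos.le]
  gcongr
  refine (norm_integral_le_integral_norm _).trans_eq ?_
  simp only [norm_smul, norm_exp_fourier_kernel, one_mul]

/-- Carleson averages dominate all generalized Fourier coefficients of nearby frequency. -/
theorem exists_norm_intervalFourierCoeff_le_carlesonAvg : ∃ D : ℝ, 0 < D ∧
    ∀ (X : Type u) [NormedAddCommGroup X] [NormedSpace ℂ X] (f : ℝ → X) (a b : ℝ), a < b →
      IntegrableOn f (Ioo a b) volume → ∀ (k : ℤ) (α : ℝ), |α - k| ≤ 2 →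
        ‖intervalFourierCoeff f a b α‖ ≤ D * carlesonAvg f a b k := by
  obtain ⟨D, hD, hexp⟩ := exists_hasSum_exp
  have hγ : 0 < ∑' μ : ℤ, (1 + (μ : ℝ) ^ 2)⁻¹ :=
    summable_one_add_sq_inv.tsum_pos (fun μ => by positivity) 0 (by norm_num)
  refine ⟨D * ∑' μ : ℤ, (1 + (μ : ℝ) ^ 2)⁻¹, by positivity, ?_⟩
  intro X _ _ f a b hab hf k α hα
  obtain ⟨c, hc, hsum⟩ := hexp (α - k) hα
  have hpos : 0 < b - a := sub_pos.2 hab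
  have hposC : (b : ℂ) - (a : ℂ) ≠ 0 := by
    rw [← Complex.ofReal_sub]; exact_mod_cast hpos.ne'
  set m : ℝ := (a + b) / 2 with hm
  let d : ℤ → ℂ := fun μ =>
    c μ * Complex.exp (((2 * π * (μ / 3 - (α - k)) * m / (b - a) : ℝ) : ℂ) * Complex.I)
  have hd : ∀ μ, ‖d μ‖ ≤ D / (1 + (μ : ℝ) ^ 2) := fun μ => by
    simpa only [d, norm_mul, Complex.norm_exp_ofReal_mul_I, mul_one] using hc μ
  let F : ℤ → ℝ → X := fun μ t => d μ • Complex.exp (-(2 * (π : ℂ) * Complex.I *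
    (((k : ℝ) + (μ : ℝ) / 3 : ℝ) : ℂ) * (t : ℂ)) / ((b : ℂ) - (a : ℂ))) • f t
  have hFsum : ∀ t ∈ Ioo a b, ∑' μ, F μ t = Complex.exp (-(2 * (π : ℂ) * Complex.I *
      (α : ℂ) * (t : ℂ)) / ((b : ℂ) - (a : ℂ))) • f t := fun t ht => by
    have hu : |(m - t) / (b - a)| ≤ 1 / 2 := by
      rw [abs_div, abs_of_pos hpos, div_le_iff₀ hpos, abs_le]
      constructor <;> linarith [ht.1, ht.2]
    have := ((hsum _ hu).mul_right (Complex.exp (-(2 * (π : ℂ) * Complex.I * (k * t + (α - k) * m))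
      / ((b : ℂ) - (a : ℂ))))).smul_const (f t)
    refine HasSum.tsum_eq ?_
    convert this using 1
    · funext μ
      simp only [F, d, smul_smul, mul_assoc, ← Complex.exp_add]
      congr 3
      push_cast
      field_simp
      ring
    · rw [← Complex.exp_add]
      congr 2
      push_cast
      field_simp
      ring
  have hFint : ∀ μ, Integrable (F μ) (volume.restrict (Ioo a b)) := fun μ =>
    (hf.exp_fourier_kernel_smul a b _).smul (d μ)
  have hFnorm : Summable fun μ => ∫ t in Ioo a b, ‖F μ t‖ := by
    refine Summable.of_nonneg_of_le (fun μ => by positivity) (fun μ => ?_)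
      (summable_one_add_sq_inv.mul_left (D * ∫ t in Ioo a b, ‖f t‖))
    simp only [F, norm_smul, norm_exp_fourier_kernel, one_mul, integral_const_mul]
    calc _ ≤ D / (1 + (μ : ℝ) ^ 2) * ∫ t in Ioo a b, ‖f t‖ := by
          gcongr
          exact hd μ
      _ = _ := by ring
  have htot := hasSum_integral_of_summable_integral_norm hFint hFnorm
  rw [setIntegral_congr_fun measurableSet_Ioo hFsum] at htot
  have hterm : ∀ μ, ‖∫ t in Ioo a b, F μ t‖ ≤ (b - a) * D *
      (‖intervalFourierCoeff f a b ((k : ℝ) + (μ : ℝ) / 3)‖ / (1 + (μ : ℝ) ^ 2)) := fun μ => by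
    simp only [F]
    rw [integral_smul, norm_smul, norm_integral_exp_fourier_kernel_smul f hab]
    calc _ ≤ D / (1 + (μ : ℝ) ^ 2) *
          ((b - a) * ‖intervalFourierCoeff f a b ((k : ℝ) + (μ : ℝ) / 3)‖) := by
          gcongr
          exact hd μ
      _ = _ := by ring
  have hbound := tsum_of_norm_bounded
    ((summable_carlesonAvg f hab k).mul_left ((b - a) * D)).hasSum hterm
  rw [htot.tsum_eq, norm_integral_exp_fourier_kernel_smul f hab, tsum_mul_left, mul_assoc] at hbound
  rw [carlesonAvg, mul_assoc, mul_inv_cancel_left₀ hγ.ne']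
  exact le_of_mul_le_mul_left hbound hpos

theorem carlesonAvg_nonneg {X : Type*} [NormedAddCommGroup X] [NormedSpace ℂ X]
    (f : ℝ → X) (a b : ℝ) (k : ℤ) : 0 ≤ carlesonAvg f a b k := by
  unfold carlesonAvg
  exact mul_nonneg (inv_nonneg.2 (tsum_nonneg fun μ => by positivity))
    (tsum_nonneg fun μ => by positivity)

theorem setIntegral_Ioo_eq_sum_quarters {X : Type*} [NormedAddCommGroup X] [NormedSpace ℝ X]
    {g : ℝ → X} {A B : ℝ} (hAB : A < B) (hg : IntegrableOn g (Ioo A B) volume) :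
    ∫ t in Ioo A B, g t = ∑ i ∈ Finset.range 4,
      ∫ t in Ioo (A + (i : ℝ) * (B - A) / 4) (A + ((i : ℝ) + 1) * (B - A) / 4), g t := by
  have hIoo : ∀ {a b : ℝ}, a ≤ b → ∫ t in Ioo a b, g t = ∫ t in a..b, g t := fun h => by
    rw [intervalIntegral.integral_of_le h, integral_Ioc_eq_integral_Ioo]
  have hgI : IntervalIntegrable g volume A B :=
    (intervalIntegrable_iff_integrableOn_Ioo_of_le hAB.le).2 hg
  have hsum := intervalIntegral.sum_integral_adjacent_intervals (f := g) (μ := volume)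
    (a := fun i : ℕ => A + (i : ℝ) * (B - A) / 4) (n := 4) fun i hi => by
      refine hgI.mono_set ?_
      have hi' : (i : ℝ) + 1 ≤ 4 := by exact_mod_cast hi
      have hi0 : (0 : ℝ) ≤ i := i.cast_nonneg
      rw [uIcc_of_le hAB.le]
      refine uIcc_subset_Icc ⟨?_, ?_⟩ ⟨?_, ?_⟩ <;> push_cast <;> nlinarith
  rw [hIoo hAB.le]
  convert hsum.symm using 1
  · congr 1 <;> push_cast <;> ring
  · refine Finset.sum_congr rfl fun i _ => ?_
    rw [hIoo (by nlinarith)]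
    push_cast
    rfl

open Classical in
theorem modulated_kernel_diff_eq_integral (x t k k'' : ℝ) :
    (if t = x then 2 * (π : ℂ) * Complex.I * ((k : ℂ) - (k'' : ℂ))
      else (Complex.exp (2 * (π : ℂ) * Complex.I * (k : ℂ) * ((x : ℂ) - (t : ℂ))) -
        Complex.exp (2 * (π : ℂ) * Complex.I * (k'' : ℂ) * ((x : ℂ) - (t : ℂ)))) /
          ((x : ℂ) - (t : ℂ))) =
      ∫ s in k''..k, 2 * (π : ℂ) * Complex.I *
        Complex.exp (2 * (π : ℂ) * Complex.I * (s : ℂ) * ((x : ℂ) - (t : ℂ))) := by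
  split_ifs with h
  · subst h
    simp [intervalIntegral.integral_const]
    ring
  · have hxt : (x : ℂ) - (t : ℂ) ≠ 0 := by
      rw [← Complex.ofReal_sub]
      exact_mod_cast sub_ne_zero.2 (Ne.symm h)
    have hc : 2 * (π : ℂ) * Complex.I * ((x : ℂ) - (t : ℂ)) ≠ 0 := by
      simp [pi_ne_zero, hxt]
    have := integral_exp_mul_complex (a := k'') (b := k) hc
    simp only [mul_right_comm _ ((x : ℂ) - (t : ℂ))] at this
    rw [intervalIntegral.integral_const_mul, this]
    have h2 : 2 * (π : ℂ) * Complex.I ≠ 0 := by simp [pi_ne_zero]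
    field_simp

theorem norm_exp_mul_sub_eq_one (s x t : ℝ) :
    ‖Complex.exp (2 * (π : ℂ) * Complex.I * (s : ℂ) * ((x : ℂ) - (t : ℂ)))‖ = 1 := by
  rw [show 2 * (π : ℂ) * Complex.I * (s : ℂ) * ((x : ℂ) - (t : ℂ))
      = ((2 * π * s * (x - t) : ℝ) : ℂ) * Complex.I by push_cast; ring,
    Complex.norm_exp_ofReal_mul_I]

theorem norm_integral_exp_smul_le {X : Type*} [NormedAddCommGroup X] [NormedSpace ℂ X]
    {f : ℝ → X} {A B : ℝ} (hAB : A < B) (hf : IntegrableOn f (Ioo A B) volume) (x s : ℝ) :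
    ‖∫ t in Ioo A B, (2 * (π : ℂ) * Complex.I *
        Complex.exp (2 * (π : ℂ) * Complex.I * (s : ℂ) * ((x : ℂ) - (t : ℂ)))) • f t‖ ≤
      2 * π * ((B - A) / 4 * ∑ i ∈ Finset.range 4,
        ‖intervalFourierCoeff f (A + (i : ℝ) * (B - A) / 4) (A + ((i : ℝ) + 1) * (B - A) / 4)
          (s * ((B - A) / 4))‖) := by
  have hpos : 0 < B - A := sub_pos.2 hAB
  have hfactor : ∀ t : ℝ, (2 * (π : ℂ) * Complex.I *
      Complex.exp (2 * (π : ℂ) * Complex.I * (s : ℂ) * ((x : ℂ) - (t : ℂ)))) • f t =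
      (2 * (π : ℂ) * Complex.I * Complex.exp (2 * (π : ℂ) * Complex.I * (s : ℂ) *
        ((x : ℂ) - ((0 : ℝ) : ℂ)))) •
      Complex.exp (-(2 * (π : ℂ) * Complex.I * (s : ℂ) * (t : ℂ)) /
        (((1 : ℝ) : ℂ) - ((0 : ℝ) : ℂ))) • f t := fun t => by
    rw [smul_smul, mul_assoc _ (Complex.exp _) (Complex.exp _), ← Complex.exp_add]
    congr 3
    push_cast
    ring
  simp only [hfactor]
  rw [integral_smul, norm_smul, norm_mul, norm_exp_mul_sub_eq_one, mul_one]
  have h2 : ‖2 * (π : ℂ) * Complex.I‖ = 2 * π := by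
    simp [Real.norm_of_nonneg pi_pos.le]
  rw [h2, setIntegral_Ioo_eq_sum_quarters hAB (Integrable.exp_fourier_kernel_smul hf 0 1 s),
    Finset.mul_sum]
  gcongr
  refine (norm_sum_le _ _).trans (Finset.sum_le_sum fun i _ => le_of_eq ?_)
  have hlen : A + ((i : ℝ) + 1) * (B - A) / 4 - (A + (i : ℝ) * (B - A) / 4) = (B - A) / 4 := by
    ring
  have hlt : A + (i : ℝ) * (B - A) / 4 < A + ((i : ℝ) + 1) * (B - A) / 4 := by linarith
  have key := norm_integral_exp_fourier_kernel_smul f hlt (s * ((B - A) / 4))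
  rw [hlen] at key
  rw [← key]
  congr 2
  funext t
  rw [← Complex.ofReal_sub, ← Complex.ofReal_sub, hlen]
  have : (B : ℂ) - (A : ℂ) ≠ 0 := by
    rw [← Complex.ofReal_sub]; exact_mod_cast hpos.ne'
  congr 2
  push_cast
  field_simp
  simp

open Classical in
/-- there is an absolute constant `c` such that for every Banach space `X`, every
finite interval `w* = (A,B)` with consecutive quarters `w'_1, …, w'_4`, every `f ∈ L₁(w*;X)`,
every `x ∈ ℝ` and all reals `k, k'' ≥ 0` with `|k - k''|·|w*| ≤ 4`,
`‖∫_{w*} f(t)(e^{2πik(x-t)} - e^{2πik''(x-t)})/(x-t) dt‖ ≤ c Σ_{i=1}^4 C_{[k''|w*|/4]}(f, w'_i)`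
(the kernel has a removable singularity at `t = x`, where it takes the value `2πi(k-k'')`). -/
theorem statement16 :
    ∃ c : ℝ, 0 < c ∧
      ∀ (X : Type u) [NormedAddCommGroup X] [NormedSpace ℂ X] [CompleteSpace X]
        (A B : ℝ), A < B →
        ∀ f : ℝ → X, IntegrableOn f (Ioo A B) volume →
        ∀ x k k'' : ℝ, 0 ≤ k → 0 ≤ k'' → |k - k''| * (B - A) ≤ 4 →
          ‖∫ t in Ioo A B,
              (if t = x then 2 * (π : ℂ) * Complex.I * ((k : ℂ) - (k'' : ℂ))
               else (Complex.exp (2 * (π : ℂ) * Complex.I * (k : ℂ) * ((x : ℂ) - (t : ℂ))) -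
                      Complex.exp (2 * (π : ℂ) * Complex.I * (k'' : ℂ) * ((x : ℂ) - (t : ℂ)))) /
                    ((x : ℂ) - (t : ℂ))) • f t‖ ≤
            c * ∑ i ∈ Finset.range 4,
              carlesonAvg f (A + (i : ℝ) * (B - A) / 4) (A + ((i : ℝ) + 1) * (B - A) / 4)
                ⌊k'' * (B - A) / 4⌋ := by
  obtain ⟨D, hD, hcoeff⟩ := exists_norm_intervalFourierCoeff_le_carlesonAvg.{u}
  refine ⟨2 * π * D, by positivity, ?_⟩
  intro X _ _ _ A B hAB f hf x k k'' _ _ hkk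
  have hpos : 0 < B - A := sub_pos.2 hAB
  set S := ∑ i ∈ Finset.range 4,
    carlesonAvg f (A + (i : ℝ) * (B - A) / 4) (A + ((i : ℝ) + 1) * (B - A) / 4)
      ⌊k'' * (B - A) / 4⌋
  have hS : 0 ≤ S := Finset.sum_nonneg fun i _ => carlesonAvg_nonneg _ _ _ _
  simp only [modulated_kernel_diff_eq_integral, ← intervalIntegral.integral_smul_const]
  rw [← intervalIntegral_integral_swap]
  · have hs : ∀ s ∈ uIoc k'' k, ‖∫ t in Ioo A B, (2 * (π : ℂ) * Complex.I *
        Complex.exp (2 * (π : ℂ) * Complex.I * (s : ℂ) * ((x : ℂ) - (t : ℂ)))) • f t‖ ≤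
        2 * π * ((B - A) / 4 * (D * S)) := fun s hs => by
      refine (norm_integral_exp_smul_le hAB hf x s).trans ?_
      rw [Finset.mul_sum (a := D)]
      gcongr with i hi
      have hi' : (i : ℝ) + 1 ≤ 4 := by exact_mod_cast Finset.mem_range.1 hi
      have hi0 : (0 : ℝ) ≤ i := i.cast_nonneg
      refine hcoeff X f _ _ (by linarith) (hf.mono_set (Ioo_subset_Ioo ?_ ?_)) _ _ ?_
      · have : 0 ≤ (i : ℝ) * (B - A) / 4 := by positivity
        linarith
      · nlinarith
      · have hsk : |s - k''| ≤ |k - k''| := abs_sub_left_of_mem_uIcc (uIoc_subset_uIcc hs)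
        have h1 : |(s - k'') * (B - A) / 4| ≤ 1 := by
          rw [abs_div, abs_mul, abs_of_pos hpos, abs_of_pos (by norm_num : (0 : ℝ) < 4),
            div_le_one (by norm_num)]
          exact (mul_le_mul_of_nonneg_right hsk hpos.le).trans hkk
        rw [abs_le] at h1 ⊢
        have hfl := Int.floor_le (k'' * (B - A) / 4)
        have hfl' := Int.lt_floor_add_one (k'' * (B - A) / 4)
        constructor <;> linarith [h1.1, h1.2]
    refine (intervalIntegral.norm_integral_le_of_norm_le_const hs).trans ?_
    calc _ = 2 * π * D * S * (|k - k''| * (B - A) / 4) := by ring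
      _ ≤ 2 * π * D * S * 1 := by
          gcongr
          linarith
      _ = _ := mul_one _
  · have : IsFiniteMeasure (volume.restrict (uIoc k'' k)) := by
      rw [uIoc]
      infer_instance
    have hfs : Integrable (fun p : ℝ × ℝ => f p.2)
        ((volume.restrict (uIoc k'' k)).prod (volume.restrict (Ioo A B))) := hf.comp_snd _
    refine (hfs.smul (2 * π : ℝ)).mono
      (Continuous.aestronglyMeasurable (by fun_prop) |>.smul hfs.1) (.of_forall fun p => ?_)
    simp only [Function.uncurry, Pi.smul_apply, norm_smul, norm_mul, norm_exp_mul_sub_eq_one,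
      Complex.norm_I, Complex.norm_real, Complex.norm_ofNat, mul_one, Real.norm_ofNat, le_refl]

end
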